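/- arXiv:2602.17834 — 5 statements merged into one kernel-verified Lean document; each statement's English description precedes it below -/
import Mathlib

section
/- Let A be an n×n real symmetric matrix and let k ≥ 2 be an integer. Then (tr(A^k))^2 ≤ (tr(A^2))^k. -/
theorem Finset.sum_pow_succ_le_pow_succ_sum {ι R : Type*} [CommSemiring R] [PartialOrder R]
    [IsOrderedRing R] (s : Finset ι) (f : ι → R) (hf : ∀ i ∈ s, 0 ≤ f i) (m : ℕ) :
    ∑ i ∈ s, f i ^ (m + 1) ≤ (∑ i ∈ s, f i) ^ (m + 1) := by
  simp only [pow_succ, Finset.mul_sum]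
  refine Finset.sum_le_sum fun i hi => mul_le_mul_of_nonneg_right ?_ (hf i hi)
  exact pow_le_pow_left₀ (hf i hi) (Finset.single_le_sum hf hi) m

theorem Finset.sq_sum_pow_le_pow_sum_sq {ι R : Type*} [CommRing R] [LinearOrder R]
    [IsStrictOrderedRing R] (s : Finset ι) (f : ι → R) {k : ℕ} (hk : 2 ≤ k) :
    (∑ i ∈ s, f i ^ k) ^ 2 ≤ (∑ i ∈ s, f i ^ 2) ^ k := by
  obtain ⟨m, rfl⟩ := Nat.exists_eq_add_of_le' hk
  calc (∑ i ∈ s, f i ^ (m + 2)) ^ 2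
      = (∑ i ∈ s, f i * f i ^ (m + 1)) ^ 2 := by simp only [← pow_succ']
    _ ≤ (∑ i ∈ s, f i ^ 2) * ∑ i ∈ s, (f i ^ (m + 1)) ^ 2 := Finset.sum_mul_sq_le_sq_mul_sq ..
    _ = (∑ i ∈ s, f i ^ 2) * ∑ i ∈ s, (f i ^ 2) ^ (m + 1) := by simp only [pow_right_comm]
    _ ≤ (∑ i ∈ s, f i ^ 2) * (∑ i ∈ s, f i ^ 2) ^ (m + 1) := by
      gcongr
      exact sum_pow_succ_le_pow_succ_sum s _ (fun i _ => sq_nonneg _) m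
    _ = (∑ i ∈ s, f i ^ 2) ^ (m + 2) := (pow_succ' _ _).symm

theorem Matrix.IsHermitian.trace_pow_eq_sum_eigenvalues_pow {𝕜 n : Type*} [RCLike 𝕜] [Fintype n]
    [DecidableEq n] {A : Matrix n n 𝕜} (hA : A.IsHermitian) (k : ℕ) :
    (A ^ k).trace = ∑ i, (hA.eigenvalues i : 𝕜) ^ k := by
  conv_lhs => rw [hA.spectral_theorem, ← map_pow, Unitary.conjStarAlgAut_apply,
    Matrix.trace_mul_cycle, Unitary.coe_star_mul_self, one_mul, Matrix.diagonal_pow]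
  simp [Matrix.trace_diagonal]

/-- Rivin's trace inequality: for an `n × n` real symmetric matrix `A` and `k ≥ 2`,
`(tr(A^k))^2 ≤ (tr(A^2))^k`. -/
theorem rivin_trace_inequality (n k : ℕ) (hk : 2 ≤ k)
    (A : Matrix (Fin n) (Fin n) ℝ) (hA : A.IsSymm) :
    (A ^ k).trace ^ 2 ≤ ((A ^ 2).trace) ^ k := by
  have hA' : A.IsHermitian := (Matrix.conjTranspose_eq_transpose_of_trivial A).trans hA
  simp only [hA'.trace_pow_eq_sum_eigenvalues_pow]
  exact Finset.sq_sum_pow_le_pow_sum_sq _ _ hk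
end

section
/- Let A : Fin n → Fin n → ℕ be symmetric with zero diagonal and every entry at most μ. Let t = Σ_{i<j<k} A_{ij}·A_{jk}·A_{ik} and let m = (1/2)·Σ_{i,j} A_{ij}. Then (6t)^2 ≤ (2μm)^3. -/
/-- For a function of three indices that is invariant under permuting them and vanishes when two
adjacent ones agree, the sum over all triples is six times the sum over increasing triples. -/
theorem six_mul_sum_increasing_triples {ι : Type*} [Fintype ι] [LinearOrder ι]
    (f : ι → ι → ι → ℕ) (h₁ : ∀ i j k, f i j k = f j i k) (h₂ : ∀ i j k, f i j k = f i k j)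
    (h₀ : ∀ i k, f i i k = 0) :
    6 * ∑ i, ∑ j ∈ Finset.univ.filter (fun j => i < j),
        ∑ k ∈ Finset.univ.filter (fun k => j < k), f i j k
      = ∑ i, ∑ j, ∑ k, f i j k := by
  let g : ι → ι → ι → ℕ := fun i j k => if i < j ∧ j < k then f i j k else 0
  have hg : ∑ i, ∑ j ∈ Finset.univ.filter (fun j => i < j),
      ∑ k ∈ Finset.univ.filter (fun k => j < k), f i j k = ∑ i, ∑ j, ∑ k, g i j k := by
    refine Finset.sum_congr rfl fun i _ => ?_
    rw [Finset.sum_filter]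
    refine Finset.sum_congr rfl fun j _ => ?_
    rw [Finset.sum_filter]
    by_cases hij : i < j <;> simp [g, hij]
  have hf : ∀ i j k, f i j k = g i j k + g i k j + g j i k + g j k i + g k i j + g k j i := by
    intro i j k
    simp only [g]
    grind
  have swap₁ (h : ι → ι → ι → ℕ) : ∑ i, ∑ j, ∑ k, h j i k = ∑ i, ∑ j, ∑ k, h i j k :=
    Finset.sum_comm
  have swap₂ (h : ι → ι → ι → ℕ) : ∑ i, ∑ j, ∑ k, h i k j = ∑ i, ∑ j, ∑ k, h i j k :=
    Finset.sum_congr rfl fun _ _ => Finset.sum_comm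
  have e₁ := swap₂ g
  have e₂ := swap₁ g
  have e₃ : ∑ i, ∑ j, ∑ k, g j k i = ∑ i, ∑ j, ∑ k, g i j k :=
    (swap₁ fun i j k => g i k j).trans e₁
  have e₄ : ∑ i, ∑ j, ∑ k, g k i j = ∑ i, ∑ j, ∑ k, g i j k :=
    (swap₂ fun i j k => g j i k).trans e₂
  have e₅ : ∑ i, ∑ j, ∑ k, g k j i = ∑ i, ∑ j, ∑ k, g i j k :=
    (swap₁ fun i j k => g k i j).trans e₄
  rw [hg, Finset.sum_congr rfl fun i _ => Finset.sum_congr rfl fun j _ =>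
    Finset.sum_congr rfl fun k _ => hf i j k]
  simp only [Finset.sum_add_distrib]
  lia

/-- The triangle sum of a matrix is bounded by the cube of its Frobenius norm. -/
theorem sq_sum_triangles_le_cube_sum_sq {ι : Type*} [Fintype ι] (A : ι → ι → ℕ) :
    (∑ i, ∑ j, ∑ k, A i j * A j k * A i k) ^ 2 ≤ (∑ i, ∑ j, A i j ^ 2) ^ 3 := by
  have hT : ∑ i, ∑ j, ∑ k, A i j * A j k * A i k
      = ∑ p : ι × ι, A p.1 p.2 * ∑ k, A p.1 k * A p.2 k := by
    rw [Fintype.sum_prod_type]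
    refine Finset.sum_congr rfl fun i _ => Finset.sum_congr rfl fun j _ => ?_
    rw [Finset.mul_sum]
    exact Finset.sum_congr rfl fun k _ => by ring
  have hB : ∑ p : ι × ι, (∑ k, A p.1 k * A p.2 k) ^ 2 ≤ (∑ i, ∑ j, A i j ^ 2) ^ 2 := by
    rw [sq (∑ i, ∑ j, A i j ^ 2), Finset.sum_mul_sum, Fintype.sum_prod_type]
    exact Finset.sum_le_sum fun i _ => Finset.sum_le_sum fun j _ =>
      Finset.sum_mul_sq_le_sq_mul_sq _ _ _
  calc (∑ i, ∑ j, ∑ k, A i j * A j k * A i k) ^ 2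
      ≤ (∑ p : ι × ι, A p.1 p.2 ^ 2) * ∑ p : ι × ι, (∑ k, A p.1 k * A p.2 k) ^ 2 := by
        rw [hT]
        exact Finset.sum_mul_sq_le_sq_mul_sq _ _ _
    _ ≤ (∑ i, ∑ j, A i j ^ 2) * (∑ i, ∑ j, A i j ^ 2) ^ 2 := by
        rw [Fintype.sum_prod_type]
        exact Nat.mul_le_mul_left _ hB
    _ = (∑ i, ∑ j, A i j ^ 2) ^ 3 := by ring


/-- Triangle–edge bound for multigraphs of bounded multiplicity: if `A` is symmetric with
zero diagonal and all entries at most `μ`, `t = Σ_{i<j<k} A_{ij}·A_{jk}·A_{ik}` is the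
number of triangles, and `Σ_{i,j} A_{ij} = 2m` (so `m` is the number of edges), then
`(6t)^2 ≤ (2μm)^3`. -/
theorem multigraph_triangle_edge_bound (n μ m : ℕ) (A : Fin n → Fin n → ℕ)
    (hsym : ∀ i j, A i j = A j i) (hdiag : ∀ i, A i i = 0)
    (hμ : ∀ i j, A i j ≤ μ) (hm : ∑ i, ∑ j, A i j = 2 * m) :
    (6 * ∑ i : Fin n, ∑ j ∈ Finset.univ.filter (fun j => i < j),
        ∑ k ∈ Finset.univ.filter (fun k => j < k), A i j * A j k * A i k) ^ 2
      ≤ (2 * μ * m) ^ 3 := by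
  rw [six_mul_sum_increasing_triples (fun i j k => A i j * A j k * A i k)
    (fun i j k => by rw [hsym j i]; ring) (fun i j k => by rw [hsym k j]; ring)
    (fun i k => by simp [hdiag])]
  refine (sq_sum_triangles_le_cube_sum_sq A).trans (Nat.pow_le_pow_left ?_ 3)
  calc ∑ i, ∑ j, A i j ^ 2 ≤ ∑ i, ∑ j, μ * A i j :=
        Finset.sum_le_sum fun i _ => Finset.sum_le_sum fun j _ => by
          rw [sq]
          exact Nat.mul_le_mul_right _ (hμ i j)
    _ = 2 * μ * m := by
        simp_rw [← Finset.mul_sum]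
        rw [hm]
        ring
end

section
/- Let H = (V, E) be an r-uniform hypergraph with |V| = n vertices, |E| = m edges, and 2 ≤ r ≤ n, and let t = Σ_{{u,v,w}} d(u,v)·d(v,w)·d(u,w), the sum over all 3-element subsets {u, v, w} of V, be its number of triangles. Then, as real numbers, t ≤ (√2/3) · (m · C(n−2, r−2) · C(r, 2))^{3/2}, where C(a, b) denotes the binomial coefficient. -/
/-- The Frobenius-norm bound `tr(A³)² ≤ ‖A‖³ · ‖A‖³`, for a kernel on a finite set. -/
theorem sq_sum_triangle_le_sum_sq_pow_three {α : Type*} (V : Finset α) (f : α → α → ℝ) :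
    (∑ u ∈ V, ∑ v ∈ V, ∑ w ∈ V, f u v * f v w * f u w) ^ 2 ≤
      (∑ u ∈ V, ∑ v ∈ V, f u v ^ 2) ^ 3 := by
  set S := ∑ u ∈ V, ∑ v ∈ V, f u v ^ 2 with hS
  have hS0 : 0 ≤ S := Finset.sum_nonneg fun u _ => Finset.sum_nonneg fun v _ => sq_nonneg _
  have hT : ∑ u ∈ V, ∑ v ∈ V, ∑ w ∈ V, f u v * f v w * f u w =
      ∑ x ∈ V ×ˢ V, f x.1 x.2 * ∑ v ∈ V, f x.1 v * f v x.2 := by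
    rw [Finset.sum_product]
    refine Finset.sum_congr rfl fun u _ => ?_
    rw [Finset.sum_comm]
    refine Finset.sum_congr rfl fun w _ => ?_
    rw [Finset.mul_sum]
    exact Finset.sum_congr rfl fun v _ => by ring
  have hB : ∑ x ∈ V ×ˢ V, (∑ v ∈ V, f x.1 v * f v x.2) ^ 2 ≤ S * S := by
    calc ∑ x ∈ V ×ˢ V, (∑ v ∈ V, f x.1 v * f v x.2) ^ 2
        ≤ ∑ x ∈ V ×ˢ V, (∑ v ∈ V, f x.1 v ^ 2) * ∑ v ∈ V, f v x.2 ^ 2 :=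
          Finset.sum_le_sum fun x _ => Finset.sum_mul_sq_le_sq_mul_sq _ _ _
      _ = S * S := by
          rw [Finset.sum_product]
          dsimp only
          rw [← Finset.sum_mul_sum, Finset.sum_comm (f := fun w v => f v w ^ 2)]
  have hS' : ∑ x ∈ V ×ˢ V, f x.1 x.2 ^ 2 = S := by rw [Finset.sum_product]
  rw [hT]
  calc _ ≤ (∑ x ∈ V ×ˢ V, f x.1 x.2 ^ 2) *
        ∑ x ∈ V ×ˢ V, (∑ v ∈ V, f x.1 v * f v x.2) ^ 2 := Finset.sum_mul_sq_le_sq_mul_sq _ _ _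
    _ ≤ S * (S * S) := by rw [hS']; exact mul_le_mul_of_nonneg_left hB hS0
    _ = S ^ 3 := by ring

theorem Finset.prod_powersetCard_two_of_card_three {α M : Type*} [DecidableEq α] [CommMonoid M]
    {a b c : α} (hab : a ≠ b) (hac : a ≠ c) (hbc : b ≠ c) (g : Finset α → M) :
    ∏ p ∈ ({a, b, c} : Finset α).powersetCard 2, g p = g {a, b} * g {b, c} * g {a, c} := by
  have h₁ : ({a, b} : Finset α) ≠ {b, c} := fun h => by
    have : a ∈ ({b, c} : Finset α) := h ▸ by simp
    simp [hab, hac] at this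
  have h₂ : ({a, b} : Finset α) ≠ {a, c} := fun h => by
    have : b ∈ ({a, c} : Finset α) := h ▸ by simp
    simp [hab.symm, hbc] at this
  have h₃ : ({b, c} : Finset α) ≠ {a, c} := fun h => by
    have : b ∈ ({a, c} : Finset α) := h ▸ by simp
    simp [hab.symm, hbc] at this
  have h : ({a, b, c} : Finset α).powersetCard 2 = {{a, b}, {b, c}, {a, c}} := by
    symm
    apply Finset.eq_of_subset_of_card_le
    · intro p hp
      simp only [Finset.mem_insert, Finset.mem_singleton] at hp
      rw [Finset.mem_powersetCard]
      rcases hp with rfl | rfl | rfl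
      · exact ⟨by intro x; simp; tauto, Finset.card_pair hab⟩
      · exact ⟨by intro x; simp; tauto, Finset.card_pair hbc⟩
      · exact ⟨by intro x; simp; tauto, Finset.card_pair hac⟩
    · have h3 : ({a, b, c} : Finset α).card = 3 := Finset.card_eq_three.2 ⟨a, b, c, hab, hac, hbc, rfl⟩
      have h3' : ({{a, b}, {b, c}, {a, c}} : Finset (Finset α)).card = 3 :=
        Finset.card_eq_three.2 ⟨_, _, _, h₁, h₂, h₃, rfl⟩
      rw [Finset.card_powersetCard, h3, h3']
      decide
  rw [h, Finset.prod_insert, Finset.prod_insert, Finset.prod_singleton, mul_assoc]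
  · simpa using h₃
  · simp [h₁, h₂]

/-- Each 3-subset is counted by at least six ordered triples. -/
theorem six_mul_sum_powersetCard_three_le {α : Type*} [DecidableEq α] (V : Finset α)
    (g : Finset α → ℕ) :
    6 * ∑ s ∈ V.powersetCard 3, ∏ p ∈ s.powersetCard 2, g p ≤
      ∑ u ∈ V, ∑ v ∈ V, ∑ w ∈ V, (if u = v then 0 else g {u, v}) *
        (if v = w then 0 else g {v, w}) * (if u = w then 0 else g {u, w}) := by
  set F : α × α × α → ℕ := fun x => (if x.1 = x.2.1 then 0 else g {x.1, x.2.1}) *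
        (if x.2.1 = x.2.2 then 0 else g {x.2.1, x.2.2}) *
        (if x.1 = x.2.2 then 0 else g {x.1, x.2.2}) with hF
  have hR : ∑ u ∈ V, ∑ v ∈ V, ∑ w ∈ V, (if u = v then 0 else g {u, v}) *
        (if v = w then 0 else g {v, w}) * (if u = w then 0 else g {u, w}) =
      ∑ x ∈ V ×ˢ V ×ˢ V, F x := by
    simp only [Finset.sum_product, hF]
  have hfib : ∑ s ∈ V.powersetCard 3,
      ∑ x ∈ V ×ˢ V ×ˢ V with ({x.1, x.2.1, x.2.2} : Finset α) = s, F x ≤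
        ∑ x ∈ V ×ˢ V ×ˢ V, F x :=
    Finset.sum_fiberwise_le_sum_of_sum_fiber_nonneg fun _ _ => Nat.zero_le _
  rw [hR, Finset.mul_sum]
  refine le_trans (Finset.sum_le_sum fun s hs => ?_) hfib
  obtain ⟨hsV, hs3⟩ := Finset.mem_powersetCard.1 hs
  obtain ⟨a, b, c, hab, hac, hbc, rfl⟩ := Finset.card_eq_three.1 hs3
  have ha : a ∈ V := hsV (by simp)
  have hb : b ∈ V := hsV (by simp)
  have hc : c ∈ V := hsV (by simp)
  rw [Finset.prod_powersetCard_two_of_card_three hab hac hbc]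
  have hsub : ({(a, b, c), (a, c, b), (b, a, c), (b, c, a), (c, a, b), (c, b, a)} :
      Finset (α × α × α)) ⊆
        {x ∈ V ×ˢ V ×ˢ V | ({x.1, x.2.1, x.2.2} : Finset α) = {a, b, c}} := by
    intro x hx
    simp only [Finset.mem_insert, Finset.mem_singleton] at hx
    rcases hx with rfl | rfl | rfl | rfl | rfl | rfl <;>
      simp only [Finset.mem_filter, Finset.mem_product, ha, hb, hc, true_and] <;>
      ext y <;> simp <;> tauto
  refine le_trans (le_of_eq ?_) (Finset.sum_le_sum_of_subset hsub)
  have e1 : ({b, a} : Finset α) = {a, b} := Finset.pair_comm _ _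
  have e2 : ({c, a} : Finset α) = {a, c} := Finset.pair_comm _ _
  have e3 : ({c, b} : Finset α) = {b, c} := Finset.pair_comm _ _
  simp [hF, hab, hac, hbc, hab.symm, hac.symm, hbc.symm, e1, e2, e3]
  ring

/-- In an `r`-uniform hypergraph on `V`, a pair lies in at most `C(|V| - 2, r - 2)` edges. -/
theorem pair_degree_le_choose {α : Type*} [DecidableEq α] {r : ℕ}
    {V : Finset α} {E : Finset (Finset α)} (hE : ∀ e ∈ E, e ⊆ V ∧ e.card = r)
    {u v : α} (hu : u ∈ V) (hv : v ∈ V) (huv : u ≠ v) :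
    (E.filter (fun e => {u, v} ⊆ e)).card ≤ (V.card - 2).choose (r - 2) := by
  have hsub : ({u, v} : Finset α) ⊆ V := by simp [Finset.insert_subset_iff, hu, hv]
  rw [← Finset.card_pair huv, ← Finset.card_sdiff_of_subset hsub, ← Finset.card_powersetCard]
  refine Finset.card_le_card_of_injOn (fun e => e \ {u, v}) ?_ ?_
  · intro e he
    obtain ⟨heE, hpe⟩ := Finset.mem_filter.1 (Finset.mem_coe.1 he)
    refine Finset.mem_coe.2 (Finset.mem_powersetCard.2
      ⟨Finset.sdiff_subset_sdiff (hE e heE).1 le_rfl, ?_⟩)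
    rw [Finset.card_sdiff_of_subset hpe, (hE e heE).2]
  · intro e he e' he' h
    have h1 := (Finset.mem_filter.1 (Finset.mem_coe.1 he)).2
    have h2 := (Finset.mem_filter.1 (Finset.mem_coe.1 he')).2
    rw [← Finset.sdiff_union_of_subset h1, ← Finset.sdiff_union_of_subset h2]
    exact congrArg (· ∪ {u, v}) h

/-- Summed over ordered pairs, the pair degrees of an `r`-uniform hypergraph count each edge
`2 * C(r, 2)` times. -/
theorem sum_pair_degree_eq {α : Type*} [DecidableEq α] {r : ℕ}
    {V : Finset α} {E : Finset (Finset α)} (hE : ∀ e ∈ E, e ⊆ V ∧ e.card = r) :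
    ∑ x ∈ V.offDiag, (E.filter (fun e => {x.1, x.2} ⊆ e)).card = 2 * (E.card * r.choose 2) := by
  have hcount := Finset.sum_card_bipartiteAbove_eq_sum_card_bipartiteBelow
    (s := V.offDiag) (t := E) (fun (x : α × α) (e : Finset α) => {x.1, x.2} ⊆ e)
  refine hcount.trans ?_
  have h : ∀ e ∈ E, (V.offDiag.bipartiteBelow
      (fun (x : α × α) (e : Finset α) => {x.1, x.2} ⊆ e) e).card = 2 * r.choose 2 := by
    intro e he
    have heq : V.offDiag.bipartiteBelow
        (fun (x : α × α) (e : Finset α) => {x.1, x.2} ⊆ e) e = e.offDiag := by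
      ext ⟨x, y⟩
      simp only [Finset.bipartiteBelow, Finset.mem_filter, Finset.mem_offDiag,
        Finset.insert_subset_iff, Finset.singleton_subset_iff]
      constructor
      · rintro ⟨⟨_, _, hne⟩, hx, hy⟩
        exact ⟨hx, hy, hne⟩
      · rintro ⟨hx, hy, hne⟩
        exact ⟨⟨(hE e he).1 hx, (hE e he).1 hy, hne⟩, hx, hy⟩
    rw [heq, Finset.offDiag_card, (hE e he).2, Nat.choose_two_right,
      Nat.mul_div_cancel' (Nat.even_mul_pred_self r).two_dvd, Nat.mul_sub_one]
  rw [Finset.sum_congr rfl h, Finset.sum_const, smul_eq_mul]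
  ring

theorem sum_sq_pair_degree_le {α : Type*} [DecidableEq α] {r : ℕ}
    {V : Finset α} {E : Finset (Finset α)} (hE : ∀ e ∈ E, e ⊆ V ∧ e.card = r) :
    ∑ u ∈ V, ∑ v ∈ V, (if u = v then 0 else (E.filter (fun e => {u, v} ⊆ e)).card) ^ 2 ≤
      2 * (E.card * (V.card - 2).choose (r - 2) * r.choose 2) := by
  have hoff : ∑ u ∈ V, ∑ v ∈ V, (if u = v then 0 else (E.filter (fun e => {u, v} ⊆ e)).card) ^ 2 =
      ∑ x ∈ V.offDiag, (E.filter (fun e => {x.1, x.2} ⊆ e)).card ^ 2 := by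
    have hdiag : V.offDiag = {x ∈ V ×ˢ V | x.1 ≠ x.2} := by
      ext x
      simp [Finset.mem_offDiag, and_assoc]
    rw [← Finset.sum_product', hdiag, Finset.sum_filter]
    refine Finset.sum_congr rfl fun x _ => ?_
    by_cases h : x.1 = x.2 <;> simp [h]
  rw [hoff]
  calc _ ≤ ∑ x ∈ V.offDiag, (V.card - 2).choose (r - 2) *
        (E.filter (fun e => {x.1, x.2} ⊆ e)).card := by
        refine Finset.sum_le_sum fun x hx => ?_
        obtain ⟨h1, h2, h3⟩ := Finset.mem_offDiag.1 hx
        rw [sq]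
        exact Nat.mul_le_mul_right _ (pair_degree_le_choose hE h1 h2 h3)
    _ = _ := by
        rw [← Finset.mul_sum, sum_pair_degree_eq hE]
        ring

/-- Main combinatorial bound (Theorem 3.8): an `r`-uniform hypergraph with `n` vertices and
`m` edges has at most `(√2/3)·(m·C(n−2,r−2)·C(r,2))^{3/2}` triangles, where the number of
triangles is `t = Σ_{{u,v,w}} d(u,v)·d(v,w)·d(u,w)`, the sum over 3-element vertex subsets
of the product of the pair degrees of the three pairs. -/
theorem hypergraph_triangle_edge_bound {α : Type*} [DecidableEq α]
    (n m r : ℕ) (hr : 2 ≤ r) (hrn : r ≤ n)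
    (V : Finset α) (hV : V.card = n)
    (E : Finset (Finset α)) (hE : ∀ e ∈ E, e ⊆ V ∧ e.card = r)
    (hm : E.card = m) :
    ((∑ s ∈ V.powersetCard 3, ∏ p ∈ s.powersetCard 2,
        (E.filter (fun e => p ⊆ e)).card : ℕ) : ℝ) ≤
      (Real.sqrt 2 / 3) *
        ((m * (n - 2).choose (r - 2) * r.choose 2 : ℕ) : ℝ) ^ ((3 : ℝ) / 2) := by
  subst hV hm
  set g : Finset α → ℕ := fun p => (E.filter (fun e => p ⊆ e)).card with hg
  set t := ∑ s ∈ V.powersetCard 3, ∏ p ∈ s.powersetCard 2, g p with ht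
  set N := E.card * (V.card - 2).choose (r - 2) * r.choose 2 with hN
  let f : α → α → ℕ := fun u v => if u = v then 0 else g {u, v}
  have h6 : (6 * t : ℝ) ≤ ∑ u ∈ V, ∑ v ∈ V, ∑ w ∈ V, (f u v : ℝ) * f v w * f u w := by
    exact_mod_cast six_mul_sum_powersetCard_three_le V g
  have hS : ∑ u ∈ V, ∑ v ∈ V, (f u v : ℝ) ^ 2 ≤ 2 * N := by
    exact_mod_cast sum_sq_pair_degree_le hE
  have hS0 : (0 : ℝ) ≤ ∑ u ∈ V, ∑ v ∈ V, (f u v : ℝ) ^ 2 :=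
    Finset.sum_nonneg fun u _ => Finset.sum_nonneg fun v _ => sq_nonneg _
  have ht0 : (0 : ℝ) ≤ 6 * t := mul_nonneg (by norm_num) (Nat.cast_nonneg t)
  have hsq : (6 * t : ℝ) ^ 2 ≤ (2 * N) ^ 3 :=
    calc (6 * t : ℝ) ^ 2 ≤ (∑ u ∈ V, ∑ v ∈ V, ∑ w ∈ V, (f u v : ℝ) * f v w * f u w) ^ 2 :=
          pow_le_pow_left₀ ht0 h6 2
      _ ≤ (∑ u ∈ V, ∑ v ∈ V, (f u v : ℝ) ^ 2) ^ 3 :=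
          sq_sum_triangle_le_sum_sq_pow_three V fun u v => (f u v : ℝ)
      _ ≤ (2 * N) ^ 3 := pow_le_pow_left₀ hS0 hS 3
  have hpow : (((N : ℝ)) ^ ((3 : ℝ) / 2)) ^ 2 = (N : ℝ) ^ 3 := by
    rw [← Real.rpow_natCast, ← Real.rpow_mul (Nat.cast_nonneg N), ← Real.rpow_natCast]
    norm_num
  refine abs_le_of_sq_le_sq' ?_ (by positivity) |>.2
  rw [mul_pow, hpow, div_pow, Real.sq_sqrt (by norm_num)]
  linarith
end

section
/- Let n ≥ 1 and r ≥ 2 be integers and let V be a set with |V| = n. Then the number of tuples consisting of a 3-element subset s = {u, v, w} ⊆ V together with three r-element subsets e₀, e₁, e₂ ⊆ V satisfying e₀ ∩ s = {u, v}, e₁ ∩ s = {v, w}, e₂ ∩ s = {u, w}, e₀ ∩ e₁ = {v}, e₁ ∩ e₂ = {w}, and e₀ ∩ e₂ = {u}, is at least C(n, 3) · C(n−3, r−2) · C(n−r−1, r−2) · C(n−2r+1, r−2), where C(a, b) denotes the binomial coefficient. -/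
/-- The number of ways to choose a 3-element subset `s` of `V` and then, one after another, three
`k`-element subsets of `V`, each avoiding `s` and the subsets chosen before it. -/
theorem card_sigma_powersetCard_sdiff {α : Type*} [DecidableEq α] (k : ℕ) (V : Finset α) :
    ((V.powersetCard 3).sigma fun s => ((V \ s).powersetCard k).sigma fun A =>
      (((V \ s) \ A).powersetCard k).sigma fun B => (((V \ s) \ A) \ B).powersetCard k).card =
      V.card.choose 3 * ((V.card - 3).choose k * ((V.card - 3 - k).choose k *
        (V.card - 3 - k - k).choose k)) := by
  rw [Finset.card_sigma, ← Finset.card_powersetCard 3 V]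
  refine Finset.sum_const_nat fun s hs => ?_
  obtain ⟨hsV, hs⟩ := Finset.mem_powersetCard.1 hs
  rw [← hs, ← Finset.card_sdiff_of_subset hsV, Finset.card_sigma,
    ← Finset.card_powersetCard k (V \ s)]
  refine Finset.sum_const_nat fun A hA => ?_
  obtain ⟨hAV, hA⟩ := Finset.mem_powersetCard.1 hA
  have hcard : ((V \ s) \ A).card = (V \ s).card - k := by
    rw [Finset.card_sdiff_of_subset hAV, hA]
  rw [← hcard, Finset.card_sigma, ← Finset.card_powersetCard k ((V \ s) \ A)]
  refine Finset.sum_const_nat fun B hB => ?_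
  obtain ⟨hBV, hB⟩ := Finset.mem_powersetCard.1 hB
  rw [Finset.card_powersetCard, Finset.card_sdiff_of_subset hBV, hB]

/-- Adding two distinct elements of `V` to a `k`-element subset of `V` that avoids them gives a
`(k + 2)`-element subset of `V`. -/
theorem insert_insert_mem_powersetCard {α : Type*} [DecidableEq α] {k : ℕ} {V A : Finset α}
    {a b : α} (ha : a ∈ V) (hb : b ∈ V) (hab : a ≠ b) (haA : a ∉ A) (hbA : b ∉ A)
    (hAV : A ⊆ V) (hA : A.card = k) : insert a (insert b A) ∈ V.powersetCard (k + 2) := by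
  rw [Finset.mem_powersetCard]
  refine ⟨Finset.insert_subset ha (Finset.insert_subset hb hAV), ?_⟩
  rw [Finset.card_insert_of_notMem (by simp [hab, haA]), Finset.card_insert_of_notMem hbA, hA]

/-- If `a` and `b` lie in `s`, then a set disjoint from `s` is recovered from its union with
`{a, b}` by removing `s`. -/
theorem insert_insert_sdiff_of_disjoint {α : Type*} [DecidableEq α] {s A : Finset α} {a b : α}
    (ha : a ∈ s) (hb : b ∈ s) (hA : Disjoint A s) : insert a (insert b A) \ s = A := by
  rw [Finset.insert_sdiff_of_mem _ ha, Finset.insert_sdiff_of_mem _ hb,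
    Finset.sdiff_eq_self_of_disjoint hA]

open Classical in
/-- Counting step of Lemma 3.6: in the complete `r`-uniform hypergraph on an `n`-element set
`V`, the number of tuples of a 3-element subset `s = {u,v,w} ⊆ V` together with `r`-element
subsets `e₀, e₁, e₂ ⊆ V` with `e₀ ∩ s = {u,v}`, `e₁ ∩ s = {v,w}`, `e₂ ∩ s = {u,w}`,
`e₀ ∩ e₁ = {v}`, `e₁ ∩ e₂ = {w}`, `e₀ ∩ e₂ = {u}` is at least
`C(n,3)·C(n−3,r−2)·C(n−r−1,r−2)·C(n−2r+1,r−2)`. -/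
theorem greedy_triangle_config_lower_bound {α : Type*} [DecidableEq α] (n r : ℕ)
    (hn : 1 ≤ n) (hr : 2 ≤ r) (V : Finset α) (hV : V.card = n) :
    n.choose 3 * (n - 3).choose (r - 2) * (n - r - 1).choose (r - 2)
        * (n + 1 - 2 * r).choose (r - 2) ≤
      (((V.powersetCard 3) ×ˢ ((V.powersetCard r) ×ˢ (V.powersetCard r) ×ˢ
          (V.powersetCard r))).filter
        (fun x => ∃ u v w : α, x.1 = {u, v, w} ∧
          x.2.1 ∩ x.1 = {u, v} ∧ x.2.2.1 ∩ x.1 = {v, w} ∧ x.2.2.2 ∩ x.1 = {u, w} ∧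
          x.2.1 ∩ x.2.2.1 = {v} ∧ x.2.2.1 ∩ x.2.2.2 = {w} ∧
          x.2.1 ∩ x.2.2.2 = {u})).card := by
  obtain ⟨k, rfl⟩ := Nat.exists_eq_add_of_le' hr
  have hlabel : ∀ s : Finset α, ∃ u v w : α, s ∈ V.powersetCard 3 →
      u ≠ v ∧ u ≠ w ∧ v ≠ w ∧ s = {u, v, w} := by
    intro s
    by_cases hs : s ∈ V.powersetCard 3
    · obtain ⟨u, v, w, h⟩ := Finset.card_eq_three.1 (Finset.mem_powersetCard.1 hs).2
      exact ⟨u, v, w, fun _ => h⟩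
    · have hne : V.Nonempty := Finset.card_pos.1 (by omega)
      exact ⟨hne.choose, hne.choose, hne.choose, fun h => absurd h hs⟩
  choose u v w huvw using hlabel
  have hcard := card_sigma_powersetCard_sdiff k V
  rw [hV, show n - 3 - k - k = n + 1 - 2 * (k + 2) by omega,
    show n - 3 - k = n - (k + 2) - 1 by omega] at hcard
  rw [Nat.add_sub_cancel, mul_assoc, mul_assoc, ← hcard]
  refine Finset.card_le_card_of_injOn
    (fun x => (x.1, insert (u x.1) (insert (v x.1) x.2.1),
      insert (v x.1) (insert (w x.1) x.2.2.1), insert (u x.1) (insert (w x.1) x.2.2.2))) ?_ ?_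
  · rintro ⟨s, A, B, C⟩ hx
    simp only [Finset.mem_coe, Finset.mem_sigma] at hx
    obtain ⟨hs, hA, hB, hC⟩ := hx
    obtain ⟨huv, huw, hvw, hsuvw⟩ := huvw s hs
    have hsV := (Finset.mem_powersetCard.1 hs).1
    rw [Finset.mem_powersetCard] at hA hB hC
    obtain ⟨hA, hAk⟩ := hA
    obtain ⟨hB, hBk⟩ := hB
    obtain ⟨hC, hCk⟩ := hC
    simp only [Finset.subset_iff, Finset.mem_sdiff] at hA hB hC
    simp only [Finset.mem_coe, Finset.mem_filter, Finset.mem_product]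
    clear huvw hcard
    generalize u s = a at *
    generalize v s = b at *
    generalize w s = c at *
    subst hsuvw
    refine ⟨⟨hs, insert_insert_mem_powersetCard ?_ ?_ huv ?_ ?_ ?_ hAk,
      insert_insert_mem_powersetCard ?_ ?_ hvw ?_ ?_ ?_ hBk,
      insert_insert_mem_powersetCard ?_ ?_ huw ?_ ?_ ?_ hCk⟩, a, b, c, rfl, ?_, ?_, ?_, ?_, ?_, ?_⟩
    all_goals grind
  · rintro ⟨s, A, B, C⟩ hx ⟨s', A', B', C'⟩ hx' h
    simp only [Finset.mem_coe, Finset.mem_sigma, Finset.mem_powersetCard,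
      Finset.subset_sdiff] at hx hx'
    simp only [Prod.mk.injEq] at h
    obtain ⟨rfl, hA, hB, hC⟩ := h
    obtain ⟨-, -, -, hsuvw⟩ := huvw s (Finset.mem_powersetCard.2 hx.1)
    have hu : u s ∈ s := by grind
    have hv : v s ∈ s := by grind
    have hw : w s ∈ s := by grind
    obtain rfl : A = A' := by
      rw [← insert_insert_sdiff_of_disjoint hu hv hx.2.1.1.2, hA,
        insert_insert_sdiff_of_disjoint hu hv hx'.2.1.1.2]
    obtain rfl : B = B' := by
      rw [← insert_insert_sdiff_of_disjoint hv hw hx.2.2.1.1.1.2, hB,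
        insert_insert_sdiff_of_disjoint hv hw hx'.2.2.1.1.1.2]
    obtain rfl : C = C' := by
      rw [← insert_insert_sdiff_of_disjoint hu hw hx.2.2.2.1.1.1.2, hC,
        insert_insert_sdiff_of_disjoint hu hw hx'.2.2.2.1.1.1.2]
    rfl
end

section
/- Let H = (V, E) be a hypergraph on n = |V| vertices, let α be a real number, and define the peeling sequence A₀ = V and A_{i+1} = {v ∈ A_i : deg_{H[A_i]}(v) > 2α} for i ≥ 0. If there exists k with 2^k > n and A_k ≠ ∅, then μ(H) > α. -/
/-- The restricted edge set `E[U] = {e ∩ U : e ∈ E, |e ∩ U| ≥ 2}` (without multiplicities). -/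
def restrictedEdges {α : Type*} [DecidableEq α] (E : Finset (Finset α)) (U : Finset α) :
    Finset (Finset α) :=
  (E.filter (fun e => 2 ≤ (e ∩ U).card)).image (fun e => e ∩ U)

/-- The degree of `v` in `H[U]`: the number of `f ∈ E[U]` with `v ∈ f`. -/
def degRestrict {α : Type*} [DecidableEq α] (E : Finset (Finset α)) (U : Finset α)
    (v : α) : ℕ :=
  ((restrictedEdges E U).filter (fun f => v ∈ f)).card

/-- The density of `U`: `μ_H(U) = (Σ_{f ∈ E[U]} |f|) / |U|`. -/
noncomputable def density {α : Type*} [DecidableEq α] (E : Finset (Finset α))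
    (U : Finset α) : ℝ :=
  (∑ f ∈ restrictedEdges E U, (f.card : ℝ)) / U.card

theorem subset_of_mem_restrictedEdges {α : Type*} [DecidableEq α] {E : Finset (Finset α)}
    {U f : Finset α} (hf : f ∈ restrictedEdges E U) : f ⊆ U := by
  obtain ⟨e, -, rfl⟩ := Finset.mem_image.mp hf
  exact Finset.inter_subset_right

theorem sum_degRestrict {α : Type*} [DecidableEq α] (E : Finset (Finset α)) (U : Finset α) :
    ∑ v ∈ U, degRestrict E U v = ∑ f ∈ restrictedEdges E U, f.card := by
  have h := Finset.sum_card_bipartiteAbove_eq_sum_card_bipartiteBelow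
    (s := U) (t := restrictedEdges E U) (fun v f => v ∈ f)
  refine h.trans (Finset.sum_congr rfl fun f hf => ?_)
  rw [Finset.bipartiteBelow, Finset.filter_mem_eq_inter,
    Finset.inter_eq_right.mpr (subset_of_mem_restrictedEdges hf)]

theorem density_nonneg {α : Type*} [DecidableEq α] (E : Finset (Finset α)) (U : Finset α) :
    0 ≤ density E U := by
  unfold density
  positivity

/-- If more than half of the vertices of `U` have degree greater than `2a` in `H[U]`, then the
density of `U` exceeds `a`. -/
theorem lt_density_of_card_lt {α : Type*} [DecidableEq α] (E : Finset (Finset α))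
    (U : Finset α) (a : ℝ)
    (h : U.card < 2 * (U.filter (fun v => 2 * a < (degRestrict E U v : ℝ))).card) :
    a < density E U := by
  rcases lt_or_ge a 0 with ha | ha
  · exact ha.trans_le (density_nonneg E U)
  set W := U.filter (fun v => 2 * a < (degRestrict E U v : ℝ)) with hW
  have hWne : W.Nonempty := Finset.card_pos.mp (by omega)
  have hU : (0 : ℝ) < U.card :=
    Nat.cast_pos.mpr (Finset.card_pos.mpr (hWne.mono (Finset.filter_subset _ _)))
  rw [density, lt_div_iff₀ hU]
  have hcard : (U.card : ℝ) ≤ 2 * W.card := by exact_mod_cast h.le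
  calc a * U.card ≤ a * (2 * W.card) := mul_le_mul_of_nonneg_left hcard ha
    _ = ∑ _v ∈ W, 2 * a := by rw [Finset.sum_const, nsmul_eq_mul]; ring
    _ < ∑ v ∈ W, (degRestrict E U v : ℝ) :=
      Finset.sum_lt_sum_of_nonempty hWne fun v hv => (Finset.mem_filter.mp hv).2
    _ ≤ ∑ v ∈ U, (degRestrict E U v : ℝ) :=
      Finset.sum_le_sum_of_subset_of_nonneg (Finset.filter_subset _ _)
        fun _ _ _ => Nat.cast_nonneg _
    _ = ∑ f ∈ restrictedEdges E U, (f.card : ℝ) := by exact_mod_cast sum_degRestrict E U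

/-- A sequence of naturals that starts below `2 ^ k` and is nonzero at `k` fails to halve at some
step. -/
theorem exists_lt_two_mul_succ (c : ℕ → ℕ) (k : ℕ) (h0 : c 0 < 2 ^ k) (hk : 0 < c k) :
    ∃ i, c i < 2 * c (i + 1) := by
  by_contra! h
  have key : ∀ j, 2 ^ j * c j ≤ c 0 := by
    intro j
    induction j with
    | zero => simp
    | succ j ih =>
      calc 2 ^ (j + 1) * c (j + 1) = 2 ^ j * (2 * c (j + 1)) := by ring
        _ ≤ 2 ^ j * c j := Nat.mul_le_mul_left _ (h j)
        _ ≤ c 0 := ih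
  exact absurd ((Nat.le_mul_of_pos_right _ hk).trans (key k)) h0.not_ge

/-- Converse direction of Lemma 4.2: for a hypergraph `H = (V, E)` on `n` vertices, if the
peeling sequence `A 0 = V`, `A (i+1) = {v ∈ A i : deg_{H[A i]}(v) > 2a}` satisfies
`A k ≠ ∅` for some `k` with `2^k > n`, then the maximum density of `H` exceeds `a`, i.e.,
some nonempty `U ⊆ V` has `μ_H(U) > a`. -/
theorem peel_nonterminating_high_density {α : Type*} [DecidableEq α] (n : ℕ)
    (V : Finset α) (hn : V.card = n) (E : Finset (Finset α)) (hE : ∀ e ∈ E, e ⊆ V)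
    (a : ℝ) (A : ℕ → Finset α) (hA0 : A 0 = V)
    (hAs : ∀ i, A (i + 1) = (A i).filter (fun v => 2 * a < (degRestrict E (A i) v : ℝ)))
    (k : ℕ) (hk : n < 2 ^ k) (hne : (A k).Nonempty) :
    ∃ U : Finset α, U ⊆ V ∧ U.Nonempty ∧ a < density E U := by
  obtain ⟨i, hi⟩ := exists_lt_two_mul_succ (fun i => (A i).card) k
    (by simpa [hA0, hn] using hk) (Finset.card_pos.mpr hne)
  have hanti : Antitone A := antitone_nat_of_succ_le fun j => by
    rw [hAs j]
    exact Finset.filter_subset _ _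
  have hsucc : (A (i + 1)).Nonempty := Finset.card_pos.mp (by omega)
  refine ⟨A i, hA0 ▸ hanti (Nat.zero_le i), hsucc.mono (hanti (Nat.le_succ i)), ?_⟩
  apply lt_density_of_card_lt
  rw [← hAs i]
  exact hi
end
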